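/- Let v(x,t) = E[X₁ − X₀ | X_t = x] where X_t = tX₁ + (1−t)X₀ and X₀ has conditional density ρ(x₀|x₁) given X₁ = x₁. Then v(z,t) = E[((X₁−z)/(1−t)) η_t(X₁,z)] where η_t(x₁,z) = ρ((z−tx₁)/(1−t) | x₁) / E[ρ((z−tX₁)/(1−t) | X₁)], with expectations over X₁ ∼ π₁, for all t ∈ [0,1) and z where the denominator is positive. -/

import Mathlib

open MeasureTheory Set
open scoped NNReal ENNReal

theorem condExp_ae_eq_integral_of_map_eq_withDensity_prod
    {Ω S T F : Type*} [mΩ : MeasurableSpace Ω] [mS : MeasurableSpace S] [MeasurableSpace T]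
    [NormedAddCommGroup F] [NormedSpace ℝ F] [CompleteSpace F]
    {P : Measure Ω} [IsProbabilityMeasure P] {ν : Measure S} [SFinite ν]
    {π : Measure T} [SFinite π] {Z : Ω → S} {Y : Ω → T} (hZ : Measurable Z) (hY : Measurable Y)
    {r : S × T → ℝ≥0} (hr : Measurable r)
    (hlaw : P.map (fun ω => (Z ω, Y ω)) = (ν.prod π).withDensity (fun p => (r p : ℝ≥0∞)))
    {W : S × T → F} (hW : StronglyMeasurable W) (hint : Integrable (fun ω => W (Z ω, Y ω)) P) :
    (fun ω => ∫ y, ((r (Z ω, y) : ℝ) / ∫ y', (r (Z ω, y') : ℝ) ∂π) • W (Z ω, y) ∂π)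
      =ᵐ[P] P[fun ω => W (Z ω, Y ω) | mS.comap Z] := by
  have hZY : Measurable fun ω => (Z ω, Y ω) := hZ.prodMk hY
  set g : S → F := fun z => ∫ y, ((r (z, y) : ℝ) / ∫ y', (r (z, y') : ℝ) ∂π) • W (z, y) ∂π with hg
  have hrm : Measurable fun p : S × T => (r p : ℝ) := hr.coe_nnreal_real
  have hgm : StronglyMeasurable g := by
    apply StronglyMeasurable.integral_prod_right
      (f := fun (z : S) (y : T) => ((r (z, y) : ℝ) / ∫ y', (r (z, y') : ℝ) ∂π) • W (z, y))
    refine StronglyMeasurable.smul ?_ hW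
    refine hrm.stronglyMeasurable.div ?_
    exact (hrm.stronglyMeasurable.integral_prod_right').comp_measurable measurable_fst
  -- transfer between `P` and the product measure
  have hInt : ∀ V : S × T → F, StronglyMeasurable V →
      (Integrable (fun ω => V (Z ω, Y ω)) P ↔ Integrable (fun p => (r p : ℝ) • V p) (ν.prod π)) := by
    intro V hV
    have := integrable_map_measure (μ := P) (g := V) hV.aestronglyMeasurable hZY.aemeasurable
    rw [hlaw, integrable_withDensity_iff_integrable_smul hr] at this
    exact this.symm
  have hEq : ∀ V : S × T → F, StronglyMeasurable V →
      ∫ ω, V (Z ω, Y ω) ∂P = ∫ p, (r p : ℝ) • V p ∂(ν.prod π) := by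
    intro V hV
    rw [← integral_map (φ := fun ω => (Z ω, Y ω)) hZY.aemeasurable hV.aestronglyMeasurable, hlaw,
      integral_withDensity_eq_integral_smul hr]
    rfl
  have hri : Integrable (fun p => (r p : ℝ)) (ν.prod π) := by
    have h1 : ∫⁻ p, (r p : ℝ≥0∞) ∂(ν.prod π) = 1 := by
      have : P.map (fun ω => (Z ω, Y ω)) univ = 1 := by
        rw [Measure.map_apply hZY .univ]; simp
      rwa [hlaw, withDensity_apply _ .univ, Measure.restrict_univ] at this
    refine ⟨hrm.aestronglyMeasurable, ?_⟩
    rw [hasFiniteIntegral_iff_enorm]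
    simp [enorm_eq_nnnorm, h1]
  have hWi := (hInt W hW).1 hint
  have hkey : ∀ᵐ z ∂ν, (∫ y, (r (z, y) : ℝ) ∂π) • g z = ∫ y, (r (z, y) : ℝ) • W (z, y) ∂π := by
    filter_upwards [hri.prod_right_ae] with z hz
    by_cases hD : ∫ y, (r (z, y) : ℝ) ∂π = 0
    · rw [hD, zero_smul]
      rw [integral_eq_zero_iff_of_nonneg (fun _ => NNReal.coe_nonneg _) hz] at hD
      refine (integral_eq_zero_of_ae ?_).symm
      filter_upwards [hD] with y hy
      simp only [Pi.zero_apply] at hy ⊢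
      rw [hy, zero_smul]
    · rw [hg, ← integral_smul]
      refine integral_congr_ae (.of_forall fun y => ?_)
      simp only [smul_smul]
      rw [mul_div_cancel₀ _ hD]
  have hgi : Integrable (fun p : S × T => (r p : ℝ) • g p.1) (ν.prod π) := by
    refine (integrable_prod_iff (hrm.stronglyMeasurable.smul
      (hgm.comp_measurable measurable_fst)).aestronglyMeasurable).2 ⟨?_, ?_⟩
    · filter_upwards [hri.prod_right_ae] with z hz
      exact hz.smul_const (g z)
    · refine hWi.integral_prod_left.norm.congr ?_
      filter_upwards [hkey] with z hz
      rw [← hz, norm_smul, Real.norm_of_nonneg (integral_nonneg fun _ => NNReal.coe_nonneg _),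
        ← integral_mul_const]
      simp [norm_smul]
  have hgZ : Integrable (fun ω => g (Z ω)) P :=
    (hInt (fun p => g p.1) (hgm.comp_measurable measurable_fst)).2 hgi
  refine ae_eq_condExp_of_forall_setIntegral_eq hZ.comap_le hint
    (fun _ _ _ => hgZ.integrableOn) ?_
    (hgm.comp_measurable (comap_measurable Z)).aestronglyMeasurable
  rintro _ ⟨B, hB, rfl⟩ -
  have hset : ∀ V : S × T → F, StronglyMeasurable V →
      Integrable (fun p => (r p : ℝ) • V p) (ν.prod π) →
      ∫ ω in Z ⁻¹' B, V (Z ω, Y ω) ∂P = ∫ z in B, ∫ y, (r (z, y) : ℝ) • V (z, y) ∂π ∂ν := by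
    intro V hV hVi
    have hB' : MeasurableSet (B ×ˢ (univ : Set T)) := hB.prod .univ
    rw [← integral_indicator (hZ hB)]
    have h1 := hEq ((B ×ˢ univ).indicator V) (hV.indicator hB')
    have h2 : (Z ⁻¹' B).indicator (fun ω => V (Z ω, Y ω))
        = fun ω => (B ×ˢ (univ : Set T)).indicator V (Z ω, Y ω) := by
      ext ω; by_cases h : Z ω ∈ B <;> simp [h]
    have h3 : (fun p => (r p : ℝ) • (B ×ˢ (univ : Set T)).indicator V p)
        = (B ×ˢ (univ : Set T)).indicator (fun p => (r p : ℝ) • V p) := by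
      ext p; by_cases h : p.1 ∈ B <;> simp [indicator, h]
    rw [h2, h1, h3, integral_indicator hB',
      setIntegral_prod _ hVi.integrableOn, Measure.restrict_univ]
  rw [hset (fun p => g p.1) (hgm.comp_measurable measurable_fst) hgi, hset W hW hWi]
  refine integral_congr_ae (ae_restrict_of_ae ?_)
  filter_upwards [hkey] with z hz
  rw [← hz, integral_smul_const]

theorem aemeasurable_of_forall_aemeasurable_setIntegral_closedBall
    {S T : Type*} [PseudoMetricSpace S] [SecondCountableTopology S] [MeasurableSpace S]
    [BorelSpace S] [MeasurableSpace T]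
    {ν : Measure S} [IsLocallyFiniteMeasure ν] [ν.IsOpenPosMeasure] {π : Measure T}
    {ρ : S → T → ℝ} (hcont : ∀ y, Continuous fun x => ρ x y)
    (a : S) (h : ∀ R : ℝ, AEMeasurable (fun y => ∫ x in Metric.closedBall a R, ρ x y ∂ν) π) :
    AEMeasurable (ρ a) π := by
  obtain ⟨R₀, hR₀, hfin⟩ := ((ν.finiteAt_nhds a).exists_mem_basis Metric.nhds_basis_closedBall)
  set u : ℕ → ℝ := fun n => R₀ / (n + 1) with hu
  have hu0 : Filter.Tendsto u Filter.atTop (nhds 0) := by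
    simpa [hu, div_eq_mul_inv] using
      (tendsto_one_div_add_atTop_nhds_zero_nat (𝕜 := ℝ)).const_mul R₀
  have hupos : ∀ n, 0 < u n := fun n => by positivity
  have hule : ∀ n, u n ≤ R₀ := fun n => div_le_self hR₀.le (by linarith [n.cast_nonneg (α := ℝ)])
  have hm : ∀ n, ν.real (Metric.closedBall a (u n)) ≠ 0 := fun n =>
    (ENNReal.toReal_pos (Metric.measure_closedBall_pos ν a (hupos n)).ne'
      ((measure_mono (Metric.closedBall_subset_closedBall (hule n))).trans_lt hfin).ne).ne'
  refine aemeasurable_of_tendsto_metrizable_ae Filter.atTop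
    (f := fun n y => (∫ x in Metric.closedBall a (u n), ρ x y ∂ν)
      / ν.real (Metric.closedBall a (u n))) (fun n => (h (u n)).div_const _) (.of_forall fun y => ?_)
  have h1 := (((hcont y).continuousAt (x := a)).integral_sub_linear_isLittleO_ae (μ := ν)
    (hcont y).stronglyMeasurable.stronglyMeasurableAtFilter
    ((tendsto_closedBall_smallSets a).comp hu0)).tendsto_div_nhds_zero
  have h2 := h1.add_const (ρ a y)
  rw [zero_add] at h2
  refine h2.congr fun n => ?_
  have := hm n
  simp only [Function.comp_apply, smul_eq_mul]
  field_simp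
  ring

theorem exists_measurable_ae_forall_eq_of_continuous
    {S T : Type*} [TopologicalSpace S] [TopologicalSpace.MetrizableSpace S]
    [SecondCountableTopology S] [MeasurableSpace S]
    [OpensMeasurableSpace S] [MeasurableSpace T] {π : Measure T}
    {ρ : S → T → ℝ} (hcont : ∀ y, Continuous fun x => ρ x y) (hρ : ∀ x, AEMeasurable (ρ x) π) :
    ∃ σ : S × T → ℝ, Measurable σ ∧ ∀ᵐ y ∂π, ∀ x, σ (x, y) = ρ x y := by
  obtain ⟨D, hDc, hDd⟩ := TopologicalSpace.exists_countable_dense S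
  have hae : ∀ᵐ y ∂π, ∀ q ∈ D, ρ q y = (hρ q).mk (ρ q) y :=
    (ae_ball_iff hDc).2 fun q _ => (hρ q).ae_eq_mk
  obtain ⟨N, hN, hNm, hN0⟩ := exists_measurable_superset_of_null (ae_iff.1 hae)
  have hgood : ∀ y ∉ N, ∀ q ∈ D, ρ q y = (hρ q).mk (ρ q) y := fun y hy => by
    by_contra h
    exact hy (hN h)
  set τ : S → T → ℝ := fun x => Nᶜ.indicator (ρ x) with hτ
  have hτcont : ∀ y, Continuous fun x => τ x y := fun y => by
    by_cases hy : y ∈ N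
    · simpa [hτ, hy] using continuous_const
    · simpa [hτ, hy] using hcont y
  have hτD : ∀ q ∈ D, Measurable (τ q) := fun q hq => by
    have : τ q = Nᶜ.indicator ((hρ q).mk (ρ q)) := by
      ext y
      by_cases hy : y ∈ N
      · simp [hτ, hy]
      · simp [hτ, hy, hgood y hy q hq]
    rw [this]
    exact (hρ q).measurable_mk.indicator hNm.compl
  have hτm : ∀ x, Measurable (τ x) := fun x => by
    obtain ⟨s, hs, hsx⟩ := mem_closure_iff_seq_limit.1 (hDd x)
    refine measurable_of_tendsto_metrizable (fun n => hτD (s n) (hs n)) ?_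
    exact tendsto_pi_nhds.2 fun y => ((hτcont y).tendsto x).comp hsx
  refine ⟨Function.uncurry τ, measurable_uncurry_of_continuous_of_measurable hτcont hτm, ?_⟩
  filter_upwards [measure_eq_zero_iff_ae_notMem.1 hN0] with y hy x
  simp [hτ, hy]

/-- A conditional density, given by its action on bounded test functions, that is positive and
continuous in its first variable agrees with a jointly measurable density of the joint law. -/
theorem exists_measurable_density
    {S T : Type*} [MetricSpace S] [SecondCountableTopology S] [MeasurableSpace S]
    [BorelSpace S] [MeasurableSpace T] {ν : Measure S} [IsLocallyFiniteMeasure ν]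
    [ν.IsOpenPosMeasure] [SFinite ν] {μ : Measure (S × T)} [IsProbabilityMeasure μ]
    {ρ : S → T → ℝ} (hpos : ∀ x y, 0 < ρ x y) (hcont : ∀ y, Continuous fun x => ρ x y)
    (hρ : ∀ f : S × T → ℝ, Measurable f → (∀ p, |f p| ≤ 1) →
      ∫ p, f p ∂μ = ∫ y, ∫ x, f (x, y) * ρ x y ∂ν ∂μ.snd) :
    ∃ σ : S × T → ℝ≥0, Measurable σ ∧ (∀ᵐ y ∂μ.snd, ∀ x, (σ (x, y) : ℝ) = ρ x y) ∧
      μ = (ν.prod μ.snd).withDensity (fun p => (σ p : ℝ≥0∞)) := by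
  have hJ : ∀ f : S × T → ℝ, Measurable f → (∀ p, |f p| ≤ 1) → ∫ p, f p ∂μ ≠ 0 →
      Integrable (fun y => ∫ x, f (x, y) * ρ x y ∂ν) μ.snd := by
    intro f hf hf1 h0
    by_contra hni
    exact h0 ((hρ f hf hf1).trans (integral_undef hni))
  have hG : Integrable (fun y => ∫ x, ρ x y ∂ν) μ.snd := by
    simpa using hJ (fun _ => 1) measurable_const (by simp) (by simp)
  have hρi : ∀ᵐ y ∂μ.snd, Integrable (fun x => ρ x y) ν := by
    have hGm := hG.aemeasurable
    have hB : MeasurableSet (hGm.mk _ ⁻¹' {0}) := hGm.measurable_mk (measurableSet_singleton 0)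
    have h0 : μ.snd.real (hGm.mk _ ⁻¹' {0}) = 0 := by
      have h1 := hρ ((Prod.snd ⁻¹' (hGm.mk _ ⁻¹' {0})).indicator 1)
        (measurable_one.indicator (measurable_snd hB))
        (fun p => by by_cases h : p ∈ Prod.snd ⁻¹' (hGm.mk _ ⁻¹' {0}) <;> simp [indicator, h])
      rw [integral_indicator_one (measurable_snd hB)] at h1
      rw [measureReal_def, Measure.snd_apply hB, ← measureReal_def, h1]
      refine integral_eq_zero_of_ae ?_
      filter_upwards [hGm.ae_eq_mk] with y hy
      by_cases h : hGm.mk _ y = 0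
      · simpa [indicator, h] using hy.trans h
      · simp [indicator, h]
    rw [measureReal_eq_zero_iff, measure_eq_zero_iff_ae_notMem] at h0
    filter_upwards [h0, hGm.ae_eq_mk] with y hy hy'
    by_contra hni
    exact hy (hy'.symm.trans (integral_undef hni))
  have hA : ∀ A : Set (S × T), MeasurableSet A →
      Integrable (fun y => ∫ x, A.indicator 1 (x, y) * ρ x y ∂ν) μ.snd := by
    intro A hAm
    have hind : Measurable (A.indicator (1 : S × T → ℝ)) := measurable_one.indicator hAm
    have hind0 : ∀ p, 0 ≤ A.indicator (1 : S × T → ℝ) p :=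
      fun p => indicator_nonneg (fun _ _ => zero_le_one) p
    have hind1 : ∀ p, A.indicator (1 : S × T → ℝ) p ≤ 1 :=
      fun p => indicator_le_self' (fun _ _ => zero_le_one) p
    have hindi : Integrable (A.indicator (1 : S × T → ℝ)) μ :=
      (integrable_const (1 : ℝ)).indicator hAm
    -- the test function `(1 + indicator A) / 2` has nonzero integral, whatever the measure of `A`
    have h1 := hJ (fun p => (1 + A.indicator 1 p) / 2) ((hind.const_add 1).div_const 2)
      (fun p => by
        have := hind0 p
        have := hind1 p
        rw [abs_le]; constructor <;> linarith)
      (by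
        rw [integral_div, integral_add (integrable_const 1) hindi]
        have : 0 ≤ ∫ p, A.indicator (1 : S × T → ℝ) p ∂μ := integral_nonneg hind0
        simp only [integral_const, probReal_univ, smul_eq_mul, mul_one]
        positivity)
    refine ((h1.const_mul 2).sub hG).congr ?_
    filter_upwards [hρi] with y hy
    have hAy : Integrable (fun x => A.indicator 1 (x, y) * ρ x y) ν := by
      refine hy.bdd_mul (c := 1) (hind.comp measurable_prodMk_right).aestronglyMeasurable
        (.of_forall fun x => ?_)
      rw [Real.norm_of_nonneg (hind0 _)]
      exact hind1 _
    simp only [Pi.sub_apply]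
    rw [← integral_const_mul, ← integral_sub _ hy]
    · congr 1 with x
      ring
    · refine (hy.add hAy).congr (.of_forall fun x => ?_)
      simp only [Pi.add_apply]
      ring
  obtain ⟨τ, hτm, hτ⟩ := exists_measurable_ae_forall_eq_of_continuous (π := μ.snd) hcont
    fun a => aemeasurable_of_forall_aemeasurable_setIntegral_closedBall (ν := ν) hcont a fun R => by
      have hR : MeasurableSet (Metric.closedBall a R) := Metric.isClosed_closedBall.measurableSet
      refine (hA (Prod.fst ⁻¹' Metric.closedBall a R) (measurable_fst hR)).aemeasurable.congr
        (.of_forall fun y => ?_)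
      simp only
      rw [← integral_indicator hR]
      congr 1 with x
      by_cases h : x ∈ Metric.closedBall a R <;> simp [indicator, h]
  refine ⟨fun p => (τ p).toNNReal, hτm.real_toNNReal, ?_, ?_⟩
  · filter_upwards [hτ] with y hy x
    rw [hy, Real.coe_toNNReal _ (hpos x y).le]
  ext A hAm
  have hσm : Measurable fun p => ((τ p).toNNReal : ℝ≥0∞) := hτm.real_toNNReal.coe_nnreal_ennreal
  have h1 := hρ (A.indicator 1) (measurable_one.indicator hAm)
    (fun p => by by_cases h : p ∈ A <;> simp [h])
  have hnn : ∀ x y, 0 ≤ A.indicator 1 (x, y) * ρ x y := fun x y =>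
    mul_nonneg (indicator_nonneg (fun _ _ => zero_le_one) _) (hpos x y).le
  rw [integral_indicator_one hAm] at h1
  rw [← ofReal_measureReal, h1, ofReal_integral_eq_lintegral_ofReal (hA A hAm)
    (.of_forall fun y => integral_nonneg fun x => hnn x y), withDensity_apply _ hAm,
    ← lintegral_indicator hAm, lintegral_prod_symm' _ (hσm.indicator hAm)]
  refine lintegral_congr_ae ?_
  filter_upwards [hρi, hτ] with y hy hτy
  rw [ofReal_integral_eq_lintegral_ofReal _ (.of_forall fun x => hnn x y)]
  · refine lintegral_congr fun x => ?_
    by_cases h : (x, y) ∈ A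
    · simp [h, hτy, ENNReal.ofReal]
    · simp [h]
  · refine hy.bdd_mul (c := 1)
      ((measurable_one.indicator hAm).comp measurable_prodMk_right).aestronglyMeasurable
      (.of_forall fun x => ?_)
    by_cases h : (x, y) ∈ A <;> simp [h]

theorem map_interpolation_withDensity_prod
    {E : Type*} [NormedAddCommGroup E] [NormedSpace ℝ E] [MeasurableSpace E] [BorelSpace E]
    [SecondCountableTopology E] {ν : Measure E} [ν.IsAddRightInvariant] [SFinite ν]
    {π : Measure E} [SFinite π] {σ : E × E → ℝ≥0} (hσ : Measurable σ) {t : ℝ} (ht : 1 - t ≠ 0) :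
    ((ν.prod π).withDensity (fun p => (σ p : ℝ≥0∞))).map
        (fun p => (t • p.2 + (1 - t) • p.1, p.2))
      = ((ν.map fun x => (1 - t) • x).prod π).withDensity
        (fun p => (σ ((1 - t)⁻¹ • (p.1 - t • p.2), p.2) : ℝ≥0∞)) := by
  have hφ : Measurable fun p : E × E => (t • p.2 + (1 - t) • p.1, p.2) := by fun_prop
  have hψ : Measurable fun p : E × E => (σ ((1 - t)⁻¹ • (p.1 - t • p.2), p.2) : ℝ≥0∞) := by
    fun_prop
  have hσ' : Measurable fun p => (σ p : ℝ≥0∞) := hσ.coe_nnreal_ennreal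
  ext A hA
  rw [Measure.map_apply hφ hA, withDensity_apply _ (hφ hA), withDensity_apply _ hA,
    ← lintegral_indicator (hφ hA), ← lintegral_indicator hA,
    lintegral_prod_symm' _ (hσ'.indicator (hφ hA)), lintegral_prod_symm' _ (hψ.indicator hA)]
  refine lintegral_congr fun y => ?_
  rw [lintegral_map (f := fun x => A.indicator
      (fun p => (σ ((1 - t)⁻¹ • (p.1 - t • p.2), p.2) : ℝ≥0∞)) (x, y))
      ((hψ.indicator hA).comp measurable_prodMk_right) (by fun_prop),
    ← lintegral_add_right_eq_self _ (-((1 - t)⁻¹ • t • y))]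
  refine lintegral_congr fun x => ?_
  have h1 : t • y + (1 - t) • (x + -((1 - t)⁻¹ • t • y)) = (1 - t) • x := by
    rw [smul_add, smul_neg, smul_inv_smul₀ ht]
    abel
  have h2 : (1 - t)⁻¹ • ((1 - t) • x - t • y) = x + -((1 - t)⁻¹ • t • y) := by
    rw [smul_sub, inv_smul_smul₀ ht, sub_eq_add_neg]
  have h3 : (x + -((1 - t)⁻¹ • t • y), y) ∈
      (fun p : E × E => (t • p.2 + (1 - t) • p.1, p.2)) ⁻¹' A ↔ ((1 - t) • x, y) ∈ A := by
    rw [mem_preimage, h1]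
  by_cases h : ((1 - t) • x, y) ∈ A
  · rw [indicator_of_mem (h3.2 h), indicator_of_mem h, h2]
  · rw [indicator_of_notMem (mt h3.1 h), indicator_of_notMem h]



/-- Bayes-rule formula for the rectified flow velocity: if `X₀` has conditional
Lebesgue density `ρ(·|x₁)` given `X₁ = x₁`, then for `t ∈ [0,1)` the function
`z ↦ E[((X₁-z)/(1-t)) η_t(X₁,z)]`, with
`η_t(x₁,z) = ρ((z-t x₁)/(1-t)|x₁) / E[ρ((z-t X₁)/(1-t)|X₁)]` and expectations
over `X₁ ∼ π₁`, evaluated along `X_t`, is a version of `E[X₁ - X₀ | X_t]`. -/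
theorem stmt17 {d : ℕ} {Ω : Type*} [MeasurableSpace Ω] {P : Measure Ω}
    [IsProbabilityMeasure P]
    (X₀ X₁ : Ω → EuclideanSpace ℝ (Fin d))
    (hX₀m : Measurable X₀) (hX₁m : Measurable X₁)
    (hint : Integrable (fun ω => X₁ ω - X₀ ω) P)
    (ρ : EuclideanSpace ℝ (Fin d) → EuclideanSpace ℝ (Fin d) → ℝ)
    (hρpos : ∀ x₀ x₁, 0 < ρ x₀ x₁)
    (hρcont : ∀ x₁, Continuous fun x₀ => ρ x₀ x₁)
    -- `ρ(·|x₁)` is the conditional Lebesgue density of `X₀` given `X₁ = x₁`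
    (hρ : ∀ f : EuclideanSpace ℝ (Fin d) × EuclideanSpace ℝ (Fin d) → ℝ,
      Measurable f → (∀ p, |f p| ≤ 1) →
      ∫ ω, f (X₀ ω, X₁ ω) ∂P
        = ∫ x₁, (∫ x₀, f (x₀, x₁) * ρ x₀ x₁) ∂(Measure.map X₁ P))
    (t : ℝ) (ht : t ∈ Ico (0:ℝ) 1) :
    (fun ω => ∫ x₁,
        (ρ ((1 - t)⁻¹ • ((t • X₁ ω + (1 - t) • X₀ ω) - t • x₁)) x₁
          / ∫ x₁', ρ ((1 - t)⁻¹ • ((t • X₁ ω + (1 - t) • X₀ ω) - t • x₁')) x₁'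
              ∂(Measure.map X₁ P))
          • ((1 - t)⁻¹ • (x₁ - (t • X₁ ω + (1 - t) • X₀ ω)))
        ∂(Measure.map X₁ P))
      =ᵐ[P] P[(fun ω => X₁ ω - X₀ ω) |
        MeasurableSpace.comap (fun ω => t • X₁ ω + (1 - t) • X₀ ω)
          (borel (EuclideanSpace ℝ (Fin d)))] := by
  have ht' : 1 - t ≠ 0 := (sub_pos.2 ht.2).ne'
  set μ : Measure (EuclideanSpace ℝ (Fin d) × EuclideanSpace ℝ (Fin d)) :=
    P.map fun ω => (X₀ ω, X₁ ω) with hμ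
  have hX : Measurable fun ω => (X₀ ω, X₁ ω) := hX₀m.prodMk hX₁m
  have : IsProbabilityMeasure μ := Measure.isProbabilityMeasure_map hX.aemeasurable
  have hsnd : μ.snd = P.map X₁ := Measure.snd_map_prodMk hX₀m
  obtain ⟨σ, hσm, hσ, hμσ⟩ := exists_measurable_density (ν := volume) (μ := μ) hρpos hρcont
    (fun f hf hf1 => by
      rw [hsnd, ← hρ f hf hf1, hμ, integral_map hX.aemeasurable hf.aestronglyMeasurable])
  rw [hsnd] at hσ hμσ
  have : IsProbabilityMeasure (P.map X₁) := Measure.isProbabilityMeasure_map hX₁m.aemeasurable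
  set Z : Ω → EuclideanSpace ℝ (Fin d) := fun ω => t • X₁ ω + (1 - t) • X₀ ω with hZ
  have hZm : Measurable Z := by fun_prop
  have hlaw := map_interpolation_withDensity_prod (ν := volume) (π := P.map X₁) hσm ht'
  rw [← hμσ, hμ, Measure.map_map (by fun_prop) hX] at hlaw
  have hW : ∀ ω, (1 - t)⁻¹ • (X₁ ω - Z ω) = X₁ ω - X₀ ω := fun ω => by
    rw [inv_smul_eq_iff₀ ht', hZ]
    module
  have hmain := condExp_ae_eq_integral_of_map_eq_withDensity_prod hZm hX₁m
    (r := fun p => σ ((1 - t)⁻¹ • (p.1 - t • p.2), p.2)) (by fun_prop) hlaw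
    (W := fun p => (1 - t)⁻¹ • (p.2 - p.1)) (by fun_prop) (by simpa only [hW] using hint)
  simp only [hW] at hmain
  rw [← BorelSpace.measurable_eq (α := EuclideanSpace ℝ (Fin d))]
  refine Filter.EventuallyEq.trans (.of_forall fun ω => ?_) hmain
  have hD : ∫ y, (σ ((1 - t)⁻¹ • (Z ω - t • y), y) : ℝ) ∂(P.map X₁)
      = ∫ y, ρ ((1 - t)⁻¹ • (Z ω - t • y)) y ∂(P.map X₁) :=
    integral_congr_ae (hσ.mono fun y hy => hy _)
  refine integral_congr_ae (hσ.mono fun y hy => ?_)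
  simp only [hD, hy]
  rfl
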